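/- arXiv:1404.0345 — 2 statements merged into one kernel-verified Lean document; each statement's English description precedes it below -/
import Mathlib

section
/- Let H: ℝ^d → ℝ^d be continuously differentiable and suppose there are constants L₀, L₁, L₂ ≥ 0 and N_κ > 0 such that for all x ∈ ℝ^d: |H(x)| ≤ L₀ + L₁|x|, |∇H(x)| ≤ L₂, and the matrix I_d + ∇H(x) is invertible with |(I_d + ∇H(x))^{−1}| ≤ N_κ. Then the map H̃(x) := x + H(x) is a C¹-diffeomorphism of ℝ^d onto itself; its inverse satisfies H̃^{−1}(x) = x − H(H̃^{−1}(x)) =: x + F(x) for all x; and for all x ∈ ℝ^d: |F(x)| ≤ L₀ + L₁L₀N_κ + L₁N_κ|x|, |∇F(x)| ≤ N_κ L₂, the matrix I_d + ∇F(x) is invertible, and |(I_d + ∇F(x))^{−1}| ≤ 1 + L₂. -/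
open scoped ENNReal RealInnerProductSpace

noncomputable section

/-- `ℝ^d` with the Euclidean norm. -/
abbrev Euc (d : ℕ) : Type := EuclideanSpace ℝ (Fin d)

/-- The weight `r₁(x) = (1 + |x|²)^{1/2}`. -/
def r1 {d : ℕ} (x : Euc d) : ℝ := Real.sqrt (1 + ‖x‖ ^ 2)

/-- Sup-norm `|f|₀ = sup_x ‖f x‖`, valued in `[0,∞]`. -/
def nrm0 {d : ℕ} {V : Type*} [NormedAddCommGroup V] (f : Euc d → V) : ℝ≥0∞ :=
  ⨆ x, (‖f x‖₊ : ℝ≥0∞)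

/-- Hölder seminorm `[f]_β = sup_{x ≠ y} ‖f x - f y‖ / ‖x - y‖^β`, valued in `[0,∞]`. -/
def hsemi {d : ℕ} {V : Type*} [NormedAddCommGroup V] (β : ℝ) (f : Euc d → V) : ℝ≥0∞ :=
  ⨆ (x : Euc d) (y : Euc d) (_ : x ≠ y),
    (‖f x - f y‖₊ : ℝ≥0∞) / ENNReal.ofReal (‖x - y‖ ^ β)

/-- Partial derivative in the `i`-th coordinate direction. -/
def pder {d : ℕ} {V : Type*} [NormedAddCommGroup V] [NormedSpace ℝ V]
    (i : Fin d) (f : Euc d → V) : Euc d → V :=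
  fun x => fderiv ℝ f x (EuclideanSpace.single i 1)

/-- Iterated partial derivative in the `i`-th coordinate direction. -/
def pderPow {d : ℕ} {V : Type*} [NormedAddCommGroup V] [NormedSpace ℝ V]
    (i : Fin d) : ℕ → (Euc d → V) → Euc d → V
  | 0, f => f
  | n + 1, f => pder i (pderPow i n f)

/-- Multi-index partial derivative `∂^γ f = ∂_1^{γ 1} ⋯ ∂_d^{γ d} f`. -/
def mder {d : ℕ} {V : Type*} [NormedAddCommGroup V] [NormedSpace ℝ V]
    (γ : Fin d → ℕ) (f : Euc d → V) : Euc d → V :=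
  (List.finRange d).foldr (fun i g => pderPow i (γ i) g) f

/-- `[β]⁻`: for `β > 0`, the nonnegative integer with `β = [β]⁻ + {β}⁺`, `{β}⁺ ∈ (0,1]`. -/
def ifl (β : ℝ) : ℕ := ⌈β⌉₊ - 1

/-- `{β}⁺`: the fractional part in `(0,1]` of `β > 0`. -/
def frc (β : ℝ) : ℝ := β - (ifl β : ℝ)

/-- Hölder norm `|f|_β = Σ_{|γ| ≤ [β]⁻} |∂^γ f|₀ + Σ_{|γ| = [β]⁻} [∂^γ f]_{{β}⁺}`,
valued in `[0,∞]`. -/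
def holNorm {d : ℕ} {V : Type*} [NormedAddCommGroup V] [NormedSpace ℝ V]
    (β : ℝ) (f : Euc d → V) : ℝ≥0∞ :=
  (∑' γ : {γ : Fin d → ℕ // (∑ i, γ i) ≤ ifl β}, nrm0 (mder γ.1 f))
    + ∑' γ : {γ : Fin d → ℕ // (∑ i, γ i) = ifl β}, hsemi (frc β) (mder γ.1 f)

/-- `H̃(x) = x + H(x)`. -/
def tilde {d : ℕ} (H : Euc d → Euc d) : Euc d → Euc d := fun x => x + H x

/-- `H̃⁻¹`, the inverse map of `H̃`. -/
def tildeInv {d : ℕ} (H : Euc d → Euc d) : Euc d → Euc d := Function.invFun (tilde H)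

/-- `F(x) = H̃⁻¹(x) - x`, so that `H̃⁻¹(x) = x + F(x)`. -/
def Fof {d : ℕ} (H : Euc d → Euc d) : Euc d → Euc d := fun x => tildeInv H x - x

section GlobalInverse

open Set Filter Topology

variable {E F : Type*} [NormedAddCommGroup E] [NormedAddCommGroup F] [NormedSpace ℝ F]

/-- `γ` is a `K`-Lipschitz lift through `f` of the ray `s ↦ f x₀ + s • v`, on `[0, t]`. -/
structure IsLipschitzRayLift (f : E → F) (x₀ : E) (v : F) (K : NNReal) (t : ℝ) (γ : ℝ → E) :
    Prop where
  lipschitz : LipschitzWith K γ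
  map_zero : γ 0 = x₀
  lifts : ∀ s ∈ Icc 0 t, f (γ s) = f x₀ + s • v

theorem IsLipschitzRayLift.mono {f : E → F} {x₀ : E} {v : F} {K : NNReal} {t t' : ℝ} {γ : ℝ → E}
    (h : IsLipschitzRayLift f x₀ v K t γ) (ht : t' ≤ t) : IsLipschitzRayLift f x₀ v K t' γ :=
  ⟨h.lipschitz, h.map_zero, fun s hs => h.lifts s ⟨hs.1, hs.2.trans ht⟩⟩

/-- The set of times up to which Lipschitz lifts exist is closed, by compactness of the set of
Lipschitz paths from a given point. -/
theorem isClosed_setOf_exists_isLipschitzRayLift [ProperSpace E] {f : E → F} (hf : Continuous f)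
    (x₀ : E) (v : F) (K : NNReal) :
    IsClosed {t : ℝ | ∃ γ, IsLipschitzRayLift f x₀ v K t γ} := by
  rw [isClosed_iff_ultrafilter]
  intro t u hut hu
  have hch : ∀ τ : ℝ, ∃ γ : ℝ → E, (∃ γ', IsLipschitzRayLift f x₀ v K τ γ') →
      IsLipschitzRayLift f x₀ v K τ γ := fun τ => by
    by_cases h : ∃ γ', IsLipschitzRayLift f x₀ v K τ γ'
    · exact ⟨h.choose, fun _ => h.choose_spec⟩
    · exact ⟨fun _ => x₀, fun h' => absurd h' h⟩
  choose Γ hΓ using hch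
  have hev : ∀ᶠ τ in (u : Filter ℝ), IsLipschitzRayLift f x₀ v K τ (Γ τ) := by
    filter_upwards [hu] with τ hτ using hΓ τ hτ
  have hC : IsCompact (pi univ fun s : ℝ => Metric.closedBall x₀ (K * dist s 0)) :=
    isCompact_univ_pi fun s => isCompact_closedBall _ _
  obtain ⟨G, -, hG⟩ := hC.ultrafilter_le_nhds' (u.map Γ) (by
    refine Ultrafilter.mem_map.2 (hev.mono fun τ hτ s _ => ?_)
    rw [Metric.mem_closedBall, ← hτ.map_zero]
    exact hτ.lipschitz.dist_le_mul s 0)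
  have hGt : ∀ s, Tendsto (fun τ => Γ τ s) u (𝓝 (G s)) := fun s => tendsto_pi_nhds.1 hG s
  have hid : Tendsto (fun τ : ℝ => τ) u (𝓝 t) := hut
  have hG0 : G 0 = x₀ := tendsto_nhds_unique (hGt 0) (tendsto_const_nhds.congr'
    (hev.mono fun τ hτ => hτ.map_zero.symm))
  refine ⟨G, LipschitzWith.of_dist_le_mul fun a b => ?_, hG0, fun s hs => ?_⟩
  · exact le_of_tendsto ((hGt a).dist (hGt b)) (hev.mono fun τ hτ => hτ.lipschitz.dist_le_mul a b)
  rcases hs.1.eq_or_lt with rfl | hs0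
  · simp [hG0]
  have hmin : Tendsto (fun τ : ℝ => min s τ) u (𝓝 s) := by
    simpa [min_eq_left hs.2] using (tendsto_const_nhds (x := s)).min hid
  have hd : Tendsto (fun τ => dist (Γ τ (min s τ)) (Γ τ s)) u (𝓝 0) := by
    refine squeeze_zero' (Eventually.of_forall fun _ => dist_nonneg)
      (hev.mono fun τ hτ => hτ.lipschitz.dist_le_mul _ _) ?_
    simpa using (hmin.dist (tendsto_const_nhds (x := s))).const_mul (K : ℝ)
  have hΓs : Tendsto (fun τ => Γ τ (min s τ)) u (𝓝 (G s)) :=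
    (hGt s).congr_dist (by simpa only [dist_comm] using hd)
  refine tendsto_nhds_unique ((hf.tendsto _).comp hΓs) ?_
  refine (tendsto_const_nhds.add (hmin.smul_const v)).congr' ?_
  have hpos : ∀ᶠ τ in (u : Filter ℝ), 0 < τ := hid.eventually (lt_mem_nhds (hs0.trans_le hs.2))
  filter_upwards [hev, hpos] with τ hτ hτ0
  exact (hτ.lifts _ ⟨le_min hs.1 hτ0.le, min_le_right _ _⟩).symm

/-- Lipschitz functions on the line which agree at a point can be glued there. -/
theorem LipschitzWith.ite_le {K : NNReal} {γ₁ γ₂ : ℝ → E} (h₁ : LipschitzWith K γ₁)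
    (h₂ : LipschitzWith K γ₂) {T : ℝ} (h : γ₁ T = γ₂ T) :
    LipschitzWith K fun s => if s ≤ T then γ₁ s else γ₂ s := by
  have key : ∀ a b : ℝ, a ≤ T → T < b → dist (γ₁ a) (γ₂ b) ≤ K * dist a b := by
    intro a b ha hb
    calc dist (γ₁ a) (γ₂ b) ≤ dist (γ₁ a) (γ₁ T) + dist (γ₁ T) (γ₂ b) := dist_triangle _ _ _
      _ ≤ K * dist a T + K * dist T b :=
        add_le_add (h₁.dist_le_mul _ _) (h ▸ h₂.dist_le_mul _ _)
      _ = K * dist a b := by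
        rw [Real.dist_eq, Real.dist_eq, Real.dist_eq, abs_of_nonpos (by linarith),
          abs_of_nonpos (by linarith), abs_of_nonpos (by linarith)]
        ring
  refine LipschitzWith.of_dist_le_mul fun a b => ?_
  rcases le_or_gt a T with ha | ha <;> rcases le_or_gt b T with hb | hb
  · simpa [ha, hb] using h₁.dist_le_mul a b
  · simpa [ha, hb.not_ge] using key a b ha hb
  · simpa [ha.not_ge, hb, dist_comm] using key b a hb ha
  · simpa [ha.not_ge, hb.not_ge] using h₂.dist_le_mul a b

variable [NormedSpace ℝ E]

/-- A Lipschitz lift of a ray can be prolonged past its end point. -/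
theorem IsLipschitzRayLift.exists_extension [CompleteSpace E] {f : E → F} {x₀ : E} {v : F}
    {N : NNReal} {T : ℝ} {γ : ℝ → E} (hT : 0 ≤ T)
    (hγ : IsLipschitzRayLift f x₀ v (N * ‖v‖₊) T γ) {f' : E ≃L[ℝ] F}
    (hf : HasStrictFDerivAt f (f' : E →L[ℝ] F) (γ T)) (hN : ‖(f'.symm : F →L[ℝ] E)‖₊ < N) :
    ∃ t > T, ∃ γ', IsLipschitzRayLift f x₀ v (N * ‖v‖₊) t γ' := by
  set g := hf.localInverse f f' (γ T) with hg
  obtain ⟨U, hU, hgU⟩ := hf.to_localInverse.exists_lipschitzOnWith_of_nnnorm_lt N hN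
  have hfT : f (γ T) = f x₀ + T • v := hγ.lifts T ⟨hT, le_rfl⟩
  have hℓ : Continuous fun s : ℝ => f x₀ + s • v := by fun_prop
  have hnhds : ∀ᶠ s : ℝ in 𝓝 T, f x₀ + s • v ∈ U ∧ f (g (f x₀ + s • v)) = f x₀ + s • v := by
    have h := hℓ.tendsto T
    rw [← hfT] at h
    exact h.eventually (Filter.Eventually.and hU hf.eventually_right_inverse)
  obtain ⟨ε, hε, hball⟩ := Metric.eventually_nhds_iff.1 hnhds
  set t := T + ε / 2 with ht
  have hTt : T ≤ t := by linarith
  have hIcc : ∀ s ∈ Icc T t, f x₀ + s • v ∈ U ∧ f (g (f x₀ + s • v)) = f x₀ + s • v := by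
    intro s hs
    refine hball ?_
    rw [Real.dist_eq, abs_of_nonneg (by linarith [hs.1])]
    linarith [hs.2]
  have hgℓ : LipschitzOnWith (N * ‖v‖₊) (fun s : ℝ => g (f x₀ + s • v)) (Icc T t) := by
    refine LipschitzOnWith.of_dist_le_mul fun a ha b hb => ?_
    refine (hgU.dist_le_mul _ (hIcc a ha).1 _ (hIcc b hb).1).trans_eq ?_
    rw [dist_add_left, dist_eq_norm, ← sub_smul, norm_smul, Real.dist_eq, Real.norm_eq_abs]
    push_cast
    ring
  let h : ℝ → E := fun s => g (f x₀ + (projIcc T t hTt s : ℝ) • v)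
  have hh : LipschitzWith (N * ‖v‖₊) h := by
    have := (hgℓ.to_restrict).comp (LipschitzWith.projIcc hTt)
    rw [mul_one] at this
    exact this
  have hhT : γ T = h T := by
    simp only [h, projIcc_left, ← hfT, hg, hf.localInverse_apply_image]
  refine ⟨t, by linarith, _, hγ.lipschitz.ite_le hh hhT, by simp [hT, hγ.map_zero],
    fun s hs => ?_⟩
  rcases le_or_gt s T with hsT | hsT
  · simpa [hsT] using hγ.lifts s ⟨hs.1, hsT⟩
  · have hs' : s ∈ Icc T t := ⟨hsT.le, hs.2⟩
    simpa [hsT.not_ge, h, projIcc_of_mem hTt hs'] using (hIcc s hs').2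

/-- Segments lift through maps whose derivative has a uniformly bounded inverse. -/
theorem exists_isLipschitzRayLift [ProperSpace E] {f : E → F} {f' : E → E ≃L[ℝ] F}
    {N : NNReal} (hf : ∀ x, HasStrictFDerivAt f (f' x : E →L[ℝ] F) x)
    (hN : ∀ x, ‖((f' x).symm : F →L[ℝ] E)‖₊ < N) (x₀ : E) (v : F) :
    ∃ γ, IsLipschitzRayLift f x₀ v (N * ‖v‖₊) 1 γ := by
  have hcont : Continuous f := continuous_iff_continuousAt.2 fun x => (hf x).continuousAt
  have hsub : Icc (0 : ℝ) 1 ⊆ {t : ℝ | ∃ γ, IsLipschitzRayLift f x₀ v (N * ‖v‖₊) t γ} := by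
    refine IsClosed.Icc_subset_of_forall_exists_gt
      ((isClosed_setOf_exists_isLipschitzRayLift hcont x₀ v _).inter isClosed_Icc) ?_ ?_
    · refine ⟨fun _ => x₀, LipschitzWith.const' x₀, rfl, fun s hs => ?_⟩
      simp [le_antisymm hs.2 hs.1]
    · rintro T ⟨⟨γ, hγ⟩, hT⟩ y hy
      obtain ⟨t, ht, γ', hγ'⟩ := hγ.exists_extension hT.1 (hf _) (hN _)
      exact ⟨min t y, ⟨γ', hγ'.mono (min_le_left _ _)⟩, lt_min ht hy, min_le_right _ _⟩
  exact hsub ⟨zero_le_one, le_rfl⟩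

theorem isLocalHomeomorph_of_hasStrictFDerivAt_equiv [CompleteSpace E] {f : E → F}
    {f' : E → E ≃L[ℝ] F} (hf : ∀ x, HasStrictFDerivAt f (f' x : E →L[ℝ] F) x) :
    IsLocalHomeomorph f := fun x =>
  ⟨(hf x).toOpenPartialHomeomorph f, (hf x).mem_toOpenPartialHomeomorph_source, rfl⟩

/-- Hadamard's global inverse function theorem. -/
theorem bijective_of_hasStrictFDerivAt_equiv [ProperSpace E] {f : E → F} {f' : E → E ≃L[ℝ] F}
    {N : NNReal} (hf : ∀ x, HasStrictFDerivAt f (f' x : E →L[ℝ] F) x)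
    (hN : ∀ x, ‖((f' x).symm : F →L[ℝ] E)‖₊ < N) : Function.Bijective f := by
  have hloc := isLocalHomeomorph_of_hasStrictFDerivAt_equiv hf
  have hsep : IsSeparatedMap f := T2Space.isSeparatedMap f
  choose γ hγ using fun v : F => exists_isLipschitzRayLift hf hN 0 v
  let φ : C(unitInterval × F, F) := ⟨fun p => f 0 + (p.1 : ℝ) • p.2, by fun_prop⟩
  let Γ : unitInterval × F → E := fun p => γ p.2 p.1
  have hΓ : Continuous Γ := by
    refine hloc.continuous_lift hsep φ (funext fun p => (hγ p.2).lifts _ p.1.2) ?_ fun v => ?_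
    · simpa [Γ, fun v => (hγ v).map_zero] using continuous_const
    · exact (hγ v).lipschitz.continuous.comp continuous_subtype_val
  let σ : F → E := fun y => Γ (1, y - f 0)
  have hσ : Continuous σ := hΓ.comp (by fun_prop)
  have hright : Function.RightInverse σ f := fun y => by
    simpa [σ, Γ] using (hγ (y - f 0)).lifts 1 ⟨zero_le_one, le_rfl⟩
  have hσ0 : σ (f 0) = 0 := by
    have h := (hγ 0).lipschitz.dist_le_mul 1 0
    simpa [σ, Γ, (hγ 0).map_zero] using h
  have hleft : σ ∘ f = id := hsep.eq_of_comp_eq hloc.isLocallyInjective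
    (hσ.comp hloc.continuous) continuous_id (funext fun x => hright (f x)) 0 hσ0
  exact ⟨Function.LeftInverse.injective (congrFun hleft), hright.surjective⟩

end GlobalInverse

/-- diffeomorphism lemma for `H̃(x) = x + H(x)`. -/
theorem stmt_9 (d : ℕ) (hd : 1 ≤ d) (L₀ L₁ L₂ Nκ : ℝ)
    (hL₀ : 0 ≤ L₀) (hL₁ : 0 ≤ L₁) (hL₂ : 0 ≤ L₂) (hNκ : 0 < Nκ)
    (H : Euc d → Euc d) (hH : ContDiff ℝ 1 H)
    (hgrowth : ∀ x, ‖H x‖ ≤ L₀ + L₁ * ‖x‖)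
    (hgrad : ∀ x, ‖fderiv ℝ H x‖ ≤ L₂)
    (hinv : ∀ x, ∃ B : Euc d →L[ℝ] Euc d,
      (1 + fderiv ℝ H x) * B = 1 ∧ B * (1 + fderiv ℝ H x) = 1 ∧ ‖B‖ ≤ Nκ) :
    Function.Bijective (tilde H)
    ∧ ContDiff ℝ 1 (tilde H)
    ∧ ContDiff ℝ 1 (tildeInv H)
    ∧ (∀ x, tildeInv H x = x - H (tildeInv H x))
    ∧ (∀ x, ‖Fof H x‖ ≤ L₀ + L₁ * L₀ * Nκ + L₁ * Nκ * ‖x‖)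
    ∧ (∀ x, ‖fderiv ℝ (Fof H) x‖ ≤ Nκ * L₂)
    ∧ (∀ x, ∃ B : Euc d →L[ℝ] Euc d,
        (1 + fderiv ℝ (Fof H) x) * B = 1 ∧ B * (1 + fderiv ℝ (Fof H) x) = 1
          ∧ ‖B‖ ≤ 1 + L₂) := by
  choose B hAB hBA hBN using hinv
  let A : Euc d → (Euc d ≃L[ℝ] Euc d) := fun x =>
    ContinuousLinearEquiv.equivOfInverse (1 + fderiv ℝ H x) (B x)
      (fun y => DFunLike.congr_fun (hBA x) y) (fun y => DFunLike.congr_fun (hAB x) y)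
  have hC : ContDiff ℝ 1 (tilde H) := contDiff_id.add hH
  have hA : ∀ x, HasStrictFDerivAt (tilde H) (A x : Euc d →L[ℝ] Euc d) x := fun x =>
    (hasStrictFDerivAt_id x).add (hH.contDiffAt.hasStrictFDerivAt one_ne_zero)
  have hAsymm : ∀ x, ((A x).symm : Euc d →L[ℝ] Euc d) = B x := fun x => rfl
  have hbij : Function.Bijective (tilde H) := by
    refine bijective_of_hasStrictFDerivAt_equiv (N := Nκ.toNNReal + 1) hA fun x => ?_
    rw [← NNReal.coe_lt_coe]
    push_cast
    rw [hAsymm, Real.coe_toNNReal _ hNκ.le]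
    linarith [hBN x]
  have hloc := isLocalHomeomorph_of_hasStrictFDerivAt_equiv hA
  have hright : ∀ x, tilde H (tildeInv H x) = x := Function.rightInverse_invFun hbij.2
  have hleft : ∀ x, tildeInv H (tilde H x) = x := Function.leftInverse_invFun hbij.1
  have hinvC : ContDiff ℝ 1 (tildeInv H) := by
    have h := (hloc.toHomeomorphOfBijective hbij).contDiff_symm
      (fun x => (hA x).hasFDerivAt) hC
    convert h using 1
    funext x
    apply hbij.1
    rw [hright]
    exact ((hloc.toHomeomorphOfBijective hbij).apply_symm_apply x).symm
  have hderiv : ∀ x, HasFDerivAt (tildeInv H) (B (tildeInv H x)) x := fun x => by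
    have h := (hA (tildeInv H x)).to_local_left_inverse (.of_forall hleft)
    rw [hright] at h
    exact h.hasFDerivAt
  have hfix : ∀ x, tildeInv H x = x - H (tildeInv H x) := fun x =>
    eq_sub_of_add_eq (hright x)
  have hlip : ∀ x y, ‖tildeInv H x - tildeInv H y‖ ≤ Nκ * ‖x - y‖ := fun x y =>
    convex_univ.norm_image_sub_le_of_norm_hasFDerivWithin_le
      (fun z _ => (hderiv z).hasFDerivWithinAt) (fun z _ => hBN _) (Set.mem_univ y)
      (Set.mem_univ x)
  have hFderiv : ∀ x, fderiv ℝ (Fof H) x = B (tildeInv H x) - 1 := fun x =>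
    ((hderiv x).sub (hasFDerivAt_id x)).fderiv
  refine ⟨hbij, hC, hinvC, hfix, fun x => ?_, fun x => ?_, fun x => ?_⟩
  · have hF : Fof H x = -H (tildeInv H x) := by
      rw [Fof, sub_eq_iff_eq_add, neg_add_eq_sub]
      exact hfix x
    have h0 : tildeInv H (H 0) = 0 := by simpa [tilde] using hleft 0
    have hx : ‖tildeInv H x‖ ≤ Nκ * (‖x‖ + L₀) := by
      calc ‖tildeInv H x‖ ≤ Nκ * ‖x - H 0‖ := by simpa [h0] using hlip x (H 0)
        _ ≤ Nκ * (‖x‖ + L₀) := by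
          gcongr
          exact (norm_sub_le _ _).trans (by simpa using hgrowth 0)
    rw [hF, norm_neg]
    calc ‖H (tildeInv H x)‖ ≤ L₀ + L₁ * ‖tildeInv H x‖ := hgrowth _
      _ ≤ L₀ + L₁ * (Nκ * (‖x‖ + L₀)) := by gcongr
      _ = _ := by ring
  · have h : B (tildeInv H x) - 1 = -(B (tildeInv H x) * fderiv ℝ H (tildeInv H x)) := by
      rw [← hBA (tildeInv H x)]
      noncomm_ring
    rw [hFderiv, h, norm_neg]
    exact (norm_mul_le _ _).trans (mul_le_mul (hBN _) (hgrad _) (norm_nonneg _) hNκ.le)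
  · refine ⟨1 + fderiv ℝ H (tildeInv H x), ?_, ?_, ?_⟩
    · rw [hFderiv, add_sub_cancel, hBA]
    · rw [hFderiv, add_sub_cancel, hAB]
    · exact (norm_add_le _ _).trans (add_le_add ContinuousLinearMap.norm_id_le (hgrad _))
end
end

section
/- Let H: ℝ^d → ℝ^d satisfy |H(x)| ≤ L₀ + L₁|x| and |∇H(x)| ≤ L₂ for all x, and assume I_d + ∇H(x) is invertible with |(I_d + ∇H(x))^{−1}| ≤ N_κ for all x; let H̃(x) = x + H(x) with inverse H̃^{−1}(x) = x + F(x), F(x) = −H(H̃^{−1}(x)). If moreover for some β > 1 the map H is sufficiently smooth that |∇H|_{β−1} is defined and |∇H|_{β−1} ≤ L₃, then there is a constant N = N(d, β, N_κ, L₃) such that |∇F|_{β−1} ≤ N |∇H|_{β−1}. -/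
open scoped ENNReal RealInnerProductSpace

noncomputable section

/-- `f` is `k` times differentiable, its derivatives up to order `k` are bounded by `C`, and the
`k`-th derivative is `α`-Hölder with constant `C`. -/
def HolderBdd {E : Type} [NormedAddCommGroup E] [NormedSpace ℝ E] (α : ℝ) :
    ℕ → ∀ {V : Type} [NormedAddCommGroup V] [NormedSpace ℝ V], ℝ → (E → V) → Prop
  | 0, _, _, _, C, f => (∀ x, ‖f x‖ ≤ C) ∧ ∀ x y, ‖f x - f y‖ ≤ C * ‖x - y‖ ^ α
  | k + 1, _, _, _, C, f =>
    (∀ x, ‖f x‖ ≤ C) ∧ Differentiable ℝ f ∧ HolderBdd α k C (fderiv ℝ f)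

namespace HolderBdd

variable {E : Type} [NormedAddCommGroup E] [NormedSpace ℝ E] {α : ℝ}

theorem norm_le {k : ℕ} {V : Type} [NormedAddCommGroup V] [NormedSpace ℝ V] {C : ℝ} {f : E → V}
    (h : HolderBdd α k C f) (x : E) : ‖f x‖ ≤ C := by
  cases k with
  | zero => exact h.1 x
  | succ k => exact h.1 x

theorem nonneg {k : ℕ} {V : Type} [NormedAddCommGroup V] [NormedSpace ℝ V] {C : ℝ} {f : E → V}
    (h : HolderBdd α k C f) : 0 ≤ C :=
  (norm_nonneg _).trans (h.norm_le 0)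

theorem mono {k : ℕ} {V : Type} [NormedAddCommGroup V] [NormedSpace ℝ V] {C D : ℝ} {f : E → V}
    (h : HolderBdd α k C f) (hCD : C ≤ D) : HolderBdd α k D f := by
  induction k generalizing V with
  | zero =>
    exact ⟨fun x => (h.1 x).trans hCD, fun x y => (h.2 x y).trans (by gcongr)⟩
  | succ k ih => exact ⟨fun x => (h.1 x).trans hCD, h.2.1, ih h.2.2⟩

theorem of_succ (hα : 0 < α) (hα1 : α ≤ 1) {k : ℕ} {V : Type} [NormedAddCommGroup V]
    [NormedSpace ℝ V] {C : ℝ} {f : E → V} (h : HolderBdd α (k + 1) C f) :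
    HolderBdd α k (2 * C) f := by
  have hC := h.nonneg
  induction k generalizing V with
  | zero =>
    refine ⟨fun x => (h.1 x).trans (by linarith), fun x y => ?_⟩
    rcases le_total ‖x - y‖ 1 with hxy | hxy
    · have h1 : ‖f x - f y‖ ≤ C * ‖x - y‖ :=
        Convex.norm_image_sub_le_of_norm_fderiv_le (s := Set.univ) (fun z _ => h.2.1 z)
          (fun z _ => h.2.2.1 z) convex_univ trivial trivial
      have h2 : ‖x - y‖ ≤ ‖x - y‖ ^ α := by
        rcases (norm_nonneg (x - y)).eq_or_lt with h0 | h0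
        · rw [← h0, Real.zero_rpow hα.ne']
        · simpa using Real.rpow_le_rpow_of_exponent_ge h0 hxy hα1
      have h3 := mul_le_mul_of_nonneg_left h2 hC
      have h4 : 0 ≤ C * ‖x - y‖ ^ α := by positivity
      linarith
    · have h1 : ‖f x - f y‖ ≤ 2 * C := by
        have := norm_sub_le (f x) (f y)
        linarith [h.1 x, h.1 y]
      have h2 : 1 ≤ ‖x - y‖ ^ α := Real.one_le_rpow hxy hα.le
      exact h1.trans (le_mul_of_one_le_right (by linarith) h2)
  | succ k ih => exact ⟨fun x => (h.1 x).trans (by linarith), h.2.1, ih h.2.2⟩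

theorem add {k : ℕ} {V : Type} [NormedAddCommGroup V] [NormedSpace ℝ V] {C D : ℝ} {f g : E → V}
    (hf : HolderBdd α k C f) (hg : HolderBdd α k D g) :
    HolderBdd α k (C + D) (fun x => f x + g x) := by
  induction k generalizing V with
  | zero =>
    refine ⟨fun x => (norm_add_le _ _).trans (add_le_add (hf.1 x) (hg.1 x)), fun x y => ?_⟩
    rw [add_sub_add_comm, add_mul]
    exact (norm_add_le _ _).trans (add_le_add (hf.2 x y) (hg.2 x y))
  | succ k ih =>
    refine ⟨fun x => (norm_add_le _ _).trans (add_le_add (hf.1 x) (hg.1 x)),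
      hf.2.1.add hg.2.1, ?_⟩
    have h : fderiv ℝ (fun x => f x + g x) = fun x => fderiv ℝ f x + fderiv ℝ g x :=
      funext fun x => fderiv_fun_add (hf.2.1 x) (hg.2.1 x)
    rw [h]
    exact ih hf.2.2 hg.2.2

theorem neg {k : ℕ} {V : Type} [NormedAddCommGroup V] [NormedSpace ℝ V] {C : ℝ} {f : E → V}
    (hf : HolderBdd α k C f) : HolderBdd α k C (fun x => -f x) := by
  induction k generalizing V with
  | zero =>
    refine ⟨fun x => (norm_neg (f x)).trans_le (hf.1 x), fun x y => ?_⟩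
    rw [← neg_sub', norm_neg]
    exact hf.2 x y
  | succ k ih =>
    refine ⟨fun x => (norm_neg (f x)).trans_le (hf.1 x), hf.2.1.neg, ?_⟩
    have h : fderiv ℝ (fun x => -f x) = fun x => -fderiv ℝ f x := funext fun _ => fderiv_fun_neg
    rw [h]
    exact ih hf.2.2

theorem zero {k : ℕ} {V : Type} [NormedAddCommGroup V] [NormedSpace ℝ V] :
    HolderBdd α k 0 (fun _ : E => (0 : V)) := by
  induction k generalizing V with
  | zero => exact ⟨by simp, by simp⟩
  | succ k ih =>
    refine ⟨by simp, differentiable_const _, ?_⟩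
    have h : fderiv ℝ (fun _ : E => (0 : V)) = fun _ => 0 := by
      ext1 x
      simp
    rw [h]
    exact ih

theorem sum {ι : Type*} (s : Finset ι) {k : ℕ} {V : Type} [NormedAddCommGroup V] [NormedSpace ℝ V]
    {C : ℝ} {f : ι → E → V} (hf : ∀ i, HolderBdd α k C (f i)) :
    HolderBdd α k (s.card * C) (fun x => ∑ i ∈ s, f i x) := by
  classical
  induction s using Finset.induction_on with
  | empty => simpa using zero
  | insert a s ha ih =>
    have h := (hf a).add ih
    simp only [Finset.sum_insert ha, Finset.card_insert_of_notMem ha]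
    refine h.mono (le_of_eq ?_)
    push_cast
    ring

theorem clm_comp {k : ℕ} {V W : Type} [NormedAddCommGroup V] [NormedSpace ℝ V]
    [NormedAddCommGroup W] [NormedSpace ℝ W] {C b : ℝ} {f : E → V} (hf : HolderBdd α k C f)
    (L : V →L[ℝ] W) (hL : ‖L‖ ≤ b) : HolderBdd α k (b * C) (fun x => L (f x)) := by
  have hb := (norm_nonneg L).trans hL
  induction k generalizing V W with
  | zero =>
    refine ⟨fun x => (L.le_of_opNorm_le hL _).trans (by gcongr; exact hf.1 x), fun x y => ?_⟩
    rw [← map_sub, mul_assoc]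
    exact (L.le_of_opNorm_le hL _).trans (by gcongr; exact hf.2 x y)
  | succ k ih =>
    refine ⟨fun x => (L.le_of_opNorm_le hL _).trans (by gcongr; exact hf.1 x),
      L.differentiable.comp hf.2.1, ?_⟩
    have h : fderiv ℝ (fun x => L (f x)) =
        fun x => ContinuousLinearMap.compL ℝ E V W L (fderiv ℝ f x) :=
      funext fun x => (L.hasFDerivAt.comp x (hf.2.1 x).hasFDerivAt).fderiv
    rw [h]
    exact ih hf.2.2 _ (ContinuousLinearMap.opNorm_le_bound _ hb fun g =>
      (L.opNorm_comp_le g).trans (mul_le_mul_of_nonneg_right hL (norm_nonneg g)))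

theorem norm_bilin_le {V W X : Type} [NormedAddCommGroup V] [NormedSpace ℝ V]
    [NormedAddCommGroup W] [NormedSpace ℝ W] [NormedAddCommGroup X] [NormedSpace ℝ X]
    {B : V →L[ℝ] W →L[ℝ] X} (hB : ‖B‖ ≤ 1) {v : V} {w : W} {C D : ℝ} (hv : ‖v‖ ≤ C)
    (hw : ‖w‖ ≤ D) : ‖B v w‖ ≤ C * D :=
  calc ‖B v w‖ ≤ ‖B‖ * ‖v‖ * ‖w‖ := B.le_opNorm₂ v w
    _ ≤ 1 * C * D := by
      have := (norm_nonneg v).trans hv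
      gcongr
    _ = C * D := by ring

theorem bilin (hα : 0 < α) (hα1 : α ≤ 1) {k : ℕ} {V W X : Type}
    [NormedAddCommGroup V] [NormedSpace ℝ V] [NormedAddCommGroup W] [NormedSpace ℝ W]
    [NormedAddCommGroup X] [NormedSpace ℝ X] {C D : ℝ} {f : E → V} {g : E → W}
    (hf : HolderBdd α k C f) (hg : HolderBdd α k D g) (B : V →L[ℝ] W →L[ℝ] X) (hB : ‖B‖ ≤ 1) :
    HolderBdd α k (2 * 4 ^ k * C * D) (fun x => B (f x) (g x)) := by
  induction k generalizing V W X C D with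
  | zero =>
    have hCD := mul_nonneg hf.nonneg hg.nonneg
    refine ⟨fun x => (norm_bilin_le hB (hf.1 x) (hg.1 x)).trans (by linarith), fun x y => ?_⟩
    have e : B (f x) (g x) - B (f y) (g y) = B (f x) (g x - g y) + B (f x - f y) (g y) := by
      simp
    rw [e]
    have h1 := norm_bilin_le hB (hf.1 x) (hg.2 x y)
    have h2 := norm_bilin_le hB (hf.2 x y) (hg.1 y)
    refine (norm_add_le _ _).trans ?_
    rw [pow_zero]
    linarith
  | succ k ih =>
    have hCD := mul_nonneg hf.nonneg hg.nonneg
    have h4 : (1 : ℝ) ≤ 4 ^ (k + 1) := one_le_pow₀ (by norm_num)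
    refine ⟨fun x => (norm_bilin_le hB (hf.1 x) (hg.1 x)).trans (by nlinarith), fun x =>
      (B.hasFDerivAt_of_bilinear (hf.2.1 x).hasFDerivAt (hg.2.1 x).hasFDerivAt).differentiableAt,
      ?_⟩
    have h : fderiv ℝ (fun x => B (f x) (g x)) = fun x =>
        B.precompR E (f x) (fderiv ℝ g x) + B.precompL E (fderiv ℝ f x) (g x) :=
      funext fun x => B.fderiv_of_bilinear (hf.2.1 x) (hg.2.1 x)
    rw [h]
    have h1 := ih (of_succ hα hα1 hf) hg.2.2 (B.precompR E) ((B.norm_precompR_le E).trans hB)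
    have h2 := ih hf.2.2 (of_succ hα hα1 hg) (B.precompL E) ((B.norm_precompL_le E).trans hB)
    refine (h1.add h2).mono (le_of_eq ?_)
    ring

/-- Composition with a map whose derivative is bounded in the Hölder norm of one order less. -/
theorem exists_comp (hα : 0 < α) (hα1 : α ≤ 1) (k : ℕ) {K : ℝ} (hK : 1 ≤ K) :
    ∃ c : ℝ, 1 ≤ c ∧ ∀ (Φ : E → E) (G : E → E →L[ℝ] E), (∀ x, HasFDerivAt Φ (G x) x) →
      (∀ x, ‖G x‖ ≤ K) → (∀ j < k, HolderBdd α j K G) →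
      ∀ (V : Type) [NormedAddCommGroup V] [NormedSpace ℝ V] (C : ℝ) (f : E → V),
        HolderBdd α k C f → HolderBdd α k (c * C) (fun x => f (Φ x)) := by
  induction k with
  | zero =>
    refine ⟨K, hK, fun Φ G hΦ hG _ V _ _ C f hf => ?_⟩
    have hC := hf.nonneg
    refine ⟨fun x => (hf.1 _).trans (le_mul_of_one_le_left hC hK), fun x y => ?_⟩
    have hlip : ‖Φ x - Φ y‖ ≤ K * ‖x - y‖ :=
      Convex.norm_image_sub_le_of_norm_hasFDerivWithin_le (s := Set.univ)
        (fun z _ => (hΦ z).hasFDerivWithinAt) (fun z _ => hG z) convex_univ trivial trivial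
    have hKα : K ^ α ≤ K := by
      simpa using Real.rpow_le_rpow_of_exponent_le hK hα1
    calc ‖f (Φ x) - f (Φ y)‖ ≤ C * ‖Φ x - Φ y‖ ^ α := hf.2 _ _
      _ ≤ C * (K * ‖x - y‖) ^ α := by gcongr
      _ = C * (K ^ α * ‖x - y‖ ^ α) := by rw [Real.mul_rpow (by linarith) (norm_nonneg _)]
      _ ≤ C * (K * ‖x - y‖ ^ α) := by gcongr
      _ = K * C * ‖x - y‖ ^ α := by ring
  | succ k ih =>
    obtain ⟨c, hc, ih⟩ := ih
    have h4 : (1 : ℝ) ≤ 4 ^ k := one_le_pow₀ (by norm_num)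
    have hcK : 1 ≤ c * K := one_le_mul_of_one_le_of_one_le hc hK
    have hc' : 1 ≤ 2 * 4 ^ k * c * K := by nlinarith
    refine ⟨2 * 4 ^ k * c * K, hc', fun Φ G hΦ hG hGj V _ _ C f hf => ?_⟩
    have hC := hf.nonneg
    refine ⟨fun x => (hf.1 _).trans (le_mul_of_one_le_left hC hc'),
      hf.2.1.comp fun x => (hΦ x).differentiableAt, ?_⟩
    have h : fderiv ℝ (fun x => f (Φ x)) =
        fun x => ContinuousLinearMap.compL ℝ E E V (fderiv ℝ f (Φ x)) (G x) :=
      funext fun x => ((hf.2.1 (Φ x)).hasFDerivAt.comp x (hΦ x)).fderiv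
    rw [h]
    have h1 := ih Φ G hΦ hG (fun j hj => hGj j (by omega)) _ C _ hf.2.2
    refine (bilin hα hα1 h1 (hGj k (by omega)) _
      (ContinuousLinearMap.norm_compL_le ℝ E E V)).mono (le_of_eq ?_)
    ring

/-- Pointwise inverses of `1 + A` inherit Hölder bounds from `A`. -/
theorem exists_inverse (𝔸 : Type) [NormedRing 𝔸] [NormedAlgebra ℝ 𝔸] [CompleteSpace 𝔸]
    (hα : 0 < α) (hα1 : α ≤ 1) (k : ℕ) {K : ℝ} (hK : 0 ≤ K)
    (L : ℝ) :
    ∃ c : ℝ, ∀ A R : E → 𝔸, (∀ x, (1 + A x) * R x = 1) → (∀ x, R x * (1 + A x) = 1) →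
      (∀ x, ‖R x‖ ≤ K) → HolderBdd α k L A → HolderBdd α k c R := by
  induction k generalizing L with
  | zero =>
    refine ⟨max K (K * L * K), fun A R h1 h2 hR hA => ⟨fun x => (hR x).trans (le_max_left _ _),
      fun x y => ?_⟩⟩
    have e : R x - R y = R x * (A y - A x) * R y := by
      have : R x * (A y - A x) * R y =
          R x * ((1 + A y) * R y) - (R x * (1 + A x)) * R y := by noncomm_ring
      rw [this, h1, h2]
      simp
    have hxy : ‖A y - A x‖ ≤ L * ‖x - y‖ ^ α := by
      rw [norm_sub_rev]
      exact hA.2 x y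
    rw [e]
    calc ‖R x * (A y - A x) * R y‖ ≤ ‖R x‖ * ‖A y - A x‖ * ‖R y‖ := norm_mul₃_le
      _ ≤ K * (L * ‖x - y‖ ^ α) * K := by
          have := hR x
          have := hR y
          gcongr
          exact mul_nonneg hK ((norm_nonneg _).trans hxy)
      _ = K * L * K * ‖x - y‖ ^ α := by ring
      _ ≤ max K (K * L * K) * ‖x - y‖ ^ α := by
          gcongr
          exact le_max_right _ _
  | succ k ih =>
    obtain ⟨c, ih⟩ := ih (2 * L)
    refine ⟨max K (2 * 4 ^ k * (2 * 4 ^ k * c * c) * L), fun A R h1 h2 hR hA => ?_⟩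
    have hRk := ih A R h1 h2 hR (of_succ hα hα1 hA)
    have hd : ∀ x, HasFDerivAt R
        (-(ContinuousLinearMap.mulLeftRight ℝ 𝔸 (R x) (R x)).comp (fderiv ℝ A x)) x := by
      intro x
      have hfun : R = fun z => Ring.inverse (1 + A z) := by
        funext z
        exact (Ring.inverse_unit ⟨1 + A z, R z, h1 z, h2 z⟩).symm
      have h3 := hasFDerivAt_ringInverse (𝕜 := ℝ)
        (⟨1 + A x, R x, h1 x, h2 x⟩ : 𝔸ˣ)
      have h4 := h3.comp x ((hA.2.1 x).hasFDerivAt.const_add 1)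
      rw [ContinuousLinearMap.neg_comp] at h4
      exact h4.congr_of_eventuallyEq (Filter.Eventually.of_forall (congrFun hfun))
    refine ⟨fun x => (hR x).trans (le_max_left _ _), fun x => (hd x).differentiableAt, ?_⟩
    have h : fderiv ℝ R = fun x => -ContinuousLinearMap.compL ℝ E 𝔸 𝔸
        (ContinuousLinearMap.mulLeftRight ℝ 𝔸 (R x) (R x)) (fderiv ℝ A x) := by
      funext x
      exact (hd x).fderiv
    rw [h]
    have hm := bilin hα hα1 hRk hRk (ContinuousLinearMap.mulLeftRight ℝ 𝔸)
      (ContinuousLinearMap.opNorm_mulLeftRight_le ℝ 𝔸)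
    exact (bilin hα hα1 hm hA.2.2 _
      (ContinuousLinearMap.norm_compL_le ℝ E _ _)).neg.mono (le_max_right _ _)

/-- Bounds for the derivative of a map solving `DΦ = R ∘ Φ`. -/
theorem exists_of_hasFDerivAt_comp (hα : 0 < α) (hα1 : α ≤ 1) (k : ℕ) (L : ℝ) :
    ∃ K : ℝ, 1 ≤ K ∧ L ≤ K ∧ ∀ (Φ : E → E) (R : E → E →L[ℝ] E),
      (∀ x, HasFDerivAt Φ (R (Φ x)) x) → HolderBdd α k L R →
      ∀ j ≤ k, HolderBdd α j K (fun x => R (Φ x)) := by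
  induction k generalizing L with
  | zero =>
    obtain ⟨c, hc, h⟩ := exists_comp (E := E) hα hα1 0 (le_max_right L 1)
    refine ⟨max (c * L) (max L 1), (le_max_right L 1).trans (le_max_right _ _),
      (le_max_left L 1).trans (le_max_right _ _), fun Φ R hΦ hR j hj => ?_⟩
    obtain rfl : j = 0 := by omega
    exact (h Φ _ hΦ (fun x => (hR.norm_le _).trans (le_max_left _ _)) (by simp) _ L R hR).mono
      (le_max_left _ _)
  | succ k ih =>
    obtain ⟨K, hK1, hLK, ih⟩ := ih (2 * L)
    obtain ⟨c, hc, h⟩ := exists_comp (E := E) hα hα1 (k + 1) (hK1.trans (le_max_right L K))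
    refine ⟨max (c * L) (max L K), (hK1.trans (le_max_right L K)).trans (le_max_right _ _),
      (le_max_left L K).trans (le_max_right _ _), fun Φ R hΦ hR j hj => ?_⟩
    have hlow := ih Φ R hΦ (of_succ hα hα1 hR)
    rcases Nat.lt_or_ge j (k + 1) with hj' | hj'
    · exact (hlow j (by omega)).mono ((le_max_right L K).trans (le_max_right _ _))
    · obtain rfl : j = k + 1 := by omega
      exact (h Φ _ hΦ (fun x => (hR.norm_le _).trans (le_max_left _ _))
        (fun i hi => (hlow i (by omega)).mono (le_max_right _ _)) _ L R hR).mono (le_max_left _ _)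

/-- The derivative of `Φ - id` is bounded in the Hölder norm in terms of `A` when `DΦ` is the
inverse of `1 + A` along `Φ`. -/
theorem exists_inverse_sub_one [CompleteSpace E] (hα : 0 < α) (hα1 : α ≤ 1) (k : ℕ) {K : ℝ}
    (hK : 0 ≤ K) (L : ℝ) :
    ∃ c : ℝ, 0 ≤ c ∧ ∀ (Φ : E → E) (A R : E → E →L[ℝ] E), (∀ x, (1 + A x) * R x = 1) →
      (∀ x, R x * (1 + A x) = 1) → (∀ x, ‖R x‖ ≤ K) → (∀ x, HasFDerivAt Φ (R (Φ x)) x) →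
      ∀ C ≤ L, HolderBdd α k C A → HolderBdd α k (c * C) (fun x => R (Φ x) - 1) := by
  obtain ⟨a, ha⟩ := exists_inverse (E := E) (E →L[ℝ] E) hα hα1 k hK L
  obtain ⟨b, hb1, hab, hb⟩ := exists_of_hasFDerivAt_comp (E := E) hα hα1 k a
  obtain ⟨c, hc1, hc⟩ := exists_comp (E := E) hα hα1 k hb1
  have hb0 : 0 ≤ b := by linarith
  refine ⟨c * (2 * 4 ^ k * b), by positivity, fun Φ A R h1 h2 hR hΦ C hCL hA => ?_⟩
  have hRk := ha A R h1 h2 hR (hA.mono hCL)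
  have hprod := bilin hα hα1 (hRk.mono hab) hA
    (ContinuousLinearMap.mul ℝ (E →L[ℝ] E)) (ContinuousLinearMap.opNorm_mul_le ℝ (E →L[ℝ] E))
  have h := hc Φ _ hΦ (fun x => (hRk.norm_le _).trans hab)
    (fun j hj => hb Φ R hΦ hRk j hj.le) _ _ _ hprod.neg
  have e : (fun x => R (Φ x) - 1) =
      fun x => -ContinuousLinearMap.mul ℝ (E →L[ℝ] E) (R (Φ x)) (A (Φ x)) := by
    funext x
    have h3 := h2 (Φ x)
    rw [mul_add, mul_one] at h3
    rw [ContinuousLinearMap.mul_apply']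
    rw [← h3]
    abel
  rw [e]
  exact h.mono (le_of_eq (by ring))

end HolderBdd

section PartialDerivatives

variable {d : ℕ} {V : Type} [NormedAddCommGroup V] [NormedSpace ℝ V]

/-- Iterated partial derivatives along a list of coordinate directions. -/
def pderList (l : List (Fin d)) (f : Euc d → V) : Euc d → V := l.foldr pder f

/-- The list of directions in which the multi-index `γ` differentiates. -/
def dirList (γ : Fin d → ℕ) : List (Fin d) :=
  (List.finRange d).flatMap fun i => List.replicate (γ i) i

theorem pderPow_eq_pderList (i : Fin d) (n : ℕ) (f : Euc d → V) :
    pderPow i n f = pderList (List.replicate n i) f := by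
  induction n with
  | zero => rfl
  | succ n ih => rw [pderPow, ih, List.replicate_succ]; rfl

theorem mder_eq_pderList (γ : Fin d → ℕ) (f : Euc d → V) : mder γ f = pderList (dirList γ) f := by
  unfold mder dirList
  induction List.finRange d with
  | nil => rfl
  | cons i l ih =>
    rw [List.foldr_cons, ih, List.flatMap_cons, pderPow_eq_pderList]
    simp only [pderList, List.foldr_append]

theorem length_dirList (γ : Fin d → ℕ) : (dirList γ).length = ∑ i, γ i := by
  simp [dirList, List.length_flatMap, Fin.sum_univ_def]

theorem perm_dirList_count (l : List (Fin d)) : l.Perm (dirList fun i => l.count i) := by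
  rw [List.perm_iff_count]
  intro a
  simp only [dirList, List.count_flatMap, Function.comp_def, List.count_replicate]
  rw [← Fin.sum_univ_def]
  simp

theorem ContDiff.pder {n : ℕ} {f : Euc d → V} (hf : ContDiff ℝ (n + 1 : ℕ) f) (i : Fin d) :
    ContDiff ℝ n (pder i f) :=
  (hf.fderiv_right (m := n) (by norm_cast)).clm_apply contDiff_const

theorem ContDiff.pderList {n : ℕ} (l : List (Fin d)) {f : Euc d → V}
    (hf : ContDiff ℝ (n + l.length : ℕ) f) : ContDiff ℝ n (pderList l f) := by
  induction l generalizing n with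
  | nil => exact hf
  | cons i l ih =>
    refine ContDiff.pder (ih ?_) i
    convert hf using 2
    simp only [List.length_cons]
    omega

theorem pder_comm {f : Euc d → V} (hf : ContDiff ℝ 2 f) (i j : Fin d) :
    pder i (pder j f) = pder j (pder i f) := by
  funext x
  have hd : DifferentiableAt ℝ (fderiv ℝ f) x :=
    (hf.fderiv_right (m := 1) (by norm_num)).differentiable (by norm_num) x
  have hsymm : IsSymmSndFDerivAt ℝ f x := hf.contDiffAt.isSymmSndFDerivAt (by simp)
  have key : ∀ a b : Fin d, pder a (pder b f) x =
      fderiv ℝ (fderiv ℝ f) x (EuclideanSpace.single a 1) (EuclideanSpace.single b 1) := by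
    intro a b
    unfold pder
    rw [fderiv_clm_apply hd (differentiableAt_const _)]
    simp
  rw [key, key]
  exact hsymm _ _

theorem pderList_perm {l l' : List (Fin d)} (h : l.Perm l') {f : Euc d → V}
    (hf : ContDiff ℝ l.length f) : pderList l f = pderList l' f := by
  induction h with
  | nil => rfl
  | cons i h ih =>
    have := ih (hf.of_le (by simp))
    simp only [pderList, List.foldr_cons] at this ⊢
    rw [this]
  | swap i j l =>
    refine pder_comm (ContDiff.pderList (n := 2) l ?_) j i
    convert hf using 2
    simp only [List.length_cons]
    omega
  | trans h₁ h₂ ih₁ ih₂ => exact (ih₁ hf).trans (ih₂ (by rwa [← h₁.length_eq]))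

theorem pderList_eq_mder (l : List (Fin d)) {f : Euc d → V} (hf : ContDiff ℝ l.length f) :
    pderList l f = mder (fun i => l.count i) f := by
  rw [mder_eq_pderList]
  exact pderList_perm (perm_dirList_count l) hf

theorem sum_count_eq_length (l : List (Fin d)) : ∑ i, l.count i = l.length := by
  rw [← length_dirList, ← (perm_dirList_count l).length_eq]

theorem HolderBdd.pder {α C : ℝ} {k : ℕ} {f : Euc d → V} (hf : HolderBdd α (k + 1) C f)
    (i : Fin d) : HolderBdd α k C (pder i f) := by
  have h := hf.2.2.clm_comp
    (ContinuousLinearMap.apply ℝ V (EuclideanSpace.single i (1 : ℝ) : Euc d)) (b := 1)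
    (ContinuousLinearMap.opNorm_le_bound _ zero_le_one fun L => by
      simpa using L.le_opNorm (EuclideanSpace.single i (1 : ℝ)))
  rwa [one_mul] at h

theorem HolderBdd.pderList {α C : ℝ} {k : ℕ} (l : List (Fin d)) {f : Euc d → V}
    (hf : HolderBdd α (k + l.length) C f) : HolderBdd α k C (pderList l f) := by
  induction l generalizing k with
  | nil => exact hf
  | cons i l ih =>
    refine HolderBdd.pder (ih ?_) i
    convert hf using 1
    simp only [List.length_cons]
    omega

theorem HolderBdd.norm_pderList_le {α C : ℝ} {k : ℕ} (l : List (Fin d)) {f : Euc d → V}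
    (hf : HolderBdd α k C f) (hl : l.length ≤ k) (x : Euc d) : ‖_root_.pderList l f x‖ ≤ C := by
  obtain ⟨m, rfl⟩ := Nat.exists_eq_add_of_le' hl
  exact (HolderBdd.pderList l hf).norm_le x

theorem fderiv_eq_sum_pder (f : Euc d → V) (x : Euc d) :
    fderiv ℝ f x = ∑ i, ContinuousLinearMap.smulRightL ℝ (Euc d) V
      (EuclideanSpace.proj i) (pder i f x) := by
  refine ContinuousLinearMap.ext fun v => ?_
  have hv : v = ∑ i, v i • (EuclideanSpace.single i (1 : ℝ) : Euc d) := by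
    simpa using ((EuclideanSpace.basisFun (Fin d) ℝ).sum_repr v).symm
  conv_lhs => rw [hv]
  simp [pder]

theorem HolderBdd.of_pderList {α C : ℝ} {k : ℕ} {f : Euc d → V} (hf : ContDiff ℝ k f)
    (hb : ∀ l : List (Fin d), l.length ≤ k → ∀ x, ‖_root_.pderList l f x‖ ≤ C)
    (hh : ∀ l : List (Fin d), l.length = k → ∀ x y,
      ‖_root_.pderList l f x - _root_.pderList l f y‖ ≤ C * ‖x - y‖ ^ α) :
    HolderBdd α k ((d + 1) ^ k * C) f := by
  induction k generalizing f with
  | zero =>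
    rw [pow_zero, one_mul]
    exact ⟨hb [] le_rfl, hh [] rfl⟩
  | succ k ih =>
    have hC : 0 ≤ C := (norm_nonneg _).trans (hb [] (by simp) 0)
    have h1 : (1 : ℝ) ≤ (d + 1) ^ (k + 1) := one_le_pow₀ (by simp)
    refine ⟨fun x => (hb [] (by simp) x).trans (le_mul_of_one_le_left hC h1),
      hf.differentiable (by simp), ?_⟩
    have hp : ∀ i, HolderBdd α k ((d + 1) ^ k * C) (_root_.pder i f) := by
      intro i
      have e : ∀ l, _root_.pderList l (_root_.pder i f) = _root_.pderList (l ++ [i]) f := by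
        intro l
        simp [_root_.pderList]
      refine ih (ContDiff.pder hf i) (fun l hl => ?_) (fun l hl => ?_)
      · rw [e]
        exact hb _ (by simpa using hl)
      · rw [e]
        exact hh _ (by simpa using hl)
    have hL : ∀ i : Fin d, ‖ContinuousLinearMap.smulRightL ℝ (Euc d) V
        (EuclideanSpace.proj i)‖ ≤ 1 := by
      intro i
      refine ContinuousLinearMap.opNorm_le_bound _ zero_le_one fun v => ?_
      refine ContinuousLinearMap.opNorm_le_bound _ (by positivity) fun w => ?_
      calc ‖w i • v‖ = ‖v‖ * ‖w i‖ := by rw [norm_smul, mul_comm]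
        _ ≤ 1 * ‖v‖ * ‖w‖ := by
          rw [one_mul]
          gcongr
          exact PiLp.norm_apply_le w i
    have hs := HolderBdd.sum Finset.univ fun i => (hp i).clm_comp _ (hL i)
    rw [show fderiv ℝ f = _ from funext (fderiv_eq_sum_pder f)]
    refine hs.mono ?_
    rw [Finset.card_univ, Fintype.card_fin, pow_succ]
    have : 0 ≤ ((d : ℝ) + 1) ^ k * C := by positivity
    nlinarith

end PartialDerivatives

section HolderNorm

variable {d : ℕ} {V : Type} [NormedAddCommGroup V]

theorem norm_le_of_nrm0_le {f : Euc d → V} {M : ℝ} (hM : 0 ≤ M)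
    (h : nrm0 f ≤ ENNReal.ofReal M) (x : Euc d) : ‖f x‖ ≤ M := by
  have h1 := (le_iSup (fun x => (‖f x‖₊ : ℝ≥0∞)) x).trans h
  rwa [← ENNReal.ofReal_le_ofReal_iff hM, ofReal_norm]

theorem nrm0_le {f : Euc d → V} {M : ℝ} (h : ∀ x, ‖f x‖ ≤ M) : nrm0 f ≤ ENNReal.ofReal M := by
  refine iSup_le fun x => ?_
  have := ENNReal.ofReal_le_ofReal (h x)
  rwa [ofReal_norm] at this

theorem norm_sub_le_of_hsemi_le {f : Euc d → V} {M α : ℝ} (hM : 0 ≤ M)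
    (h : hsemi α f ≤ ENNReal.ofReal M) (x y : Euc d) : ‖f x - f y‖ ≤ M * ‖x - y‖ ^ α := by
  rcases eq_or_ne x y with rfl | hxy
  · simp only [sub_self, norm_zero]
    positivity
  have hpos : 0 < ‖x - y‖ ^ α := Real.rpow_pos_of_pos (norm_sub_pos_iff.2 hxy) _
  have h1 : (‖f x - f y‖₊ : ℝ≥0∞) / ENNReal.ofReal (‖x - y‖ ^ α) ≤ ENNReal.ofReal M :=
    le_trans (le_iSup_of_le x (le_iSup_of_le y (le_iSup (fun _ : x ≠ y =>
      (‖f x - f y‖₊ : ℝ≥0∞) / ENNReal.ofReal (‖x - y‖ ^ α)) hxy))) h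
  rw [ENNReal.div_le_iff (by simpa using hpos) ENNReal.ofReal_ne_top,
    ← ENNReal.ofReal_mul hM] at h1
  rwa [← ENNReal.ofReal_le_ofReal_iff (by positivity), ofReal_norm]

theorem hsemi_le {f : Euc d → V} {M α : ℝ} (hM : 0 ≤ M)
    (h : ∀ x y, ‖f x - f y‖ ≤ M * ‖x - y‖ ^ α) : hsemi α f ≤ ENNReal.ofReal M := by
  refine iSup_le fun x => iSup_le fun y => iSup_le fun hxy => ?_
  have hpos : 0 < ‖x - y‖ ^ α := Real.rpow_pos_of_pos (norm_sub_pos_iff.2 hxy) _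
  rw [ENNReal.div_le_iff (by simpa using hpos) ENNReal.ofReal_ne_top, ← ENNReal.ofReal_mul hM]
  have := ENNReal.ofReal_le_ofReal (h x y)
  rwa [ofReal_norm] at this

theorem HolderBdd.of_holNorm_le [NormedSpace ℝ V] {b M : ℝ} (hM : 0 ≤ M) {f : Euc d → V}
    (hf : ContDiff ℝ (ifl b) f) (h : holNorm b f ≤ ENNReal.ofReal M) :
    HolderBdd (frc b) (ifl b) ((d + 1) ^ ifl b * M) f := by
  refine HolderBdd.of_pderList hf (fun l hl => ?_) (fun l hl => ?_)
  · rw [pderList_eq_mder l (hf.of_le (by exact_mod_cast hl))]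
    refine norm_le_of_nrm0_le hM (le_trans ?_ (le_self_add.trans h))
    exact ENNReal.le_tsum (f := fun γ : {γ : Fin d → ℕ // (∑ i, γ i) ≤ ifl b} =>
      nrm0 (mder γ.1 f)) ⟨_, (sum_count_eq_length l).trans_le hl⟩
  · rw [pderList_eq_mder l (hf.of_le (by exact_mod_cast hl.le))]
    refine norm_sub_le_of_hsemi_le hM (le_trans ?_ (le_add_self.trans h))
    exact ENNReal.le_tsum (f := fun γ : {γ : Fin d → ℕ // (∑ i, γ i) = ifl b} =>
      hsemi (frc b) (mder γ.1 f)) ⟨_, (sum_count_eq_length l).trans hl⟩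

theorem finite_sum_le (d k : ℕ) : Finite {γ : Fin d → ℕ // (∑ i, γ i) ≤ k} := by
  refine Set.Finite.subset (Set.finite_Iic (fun _ : Fin d => k)) fun γ hγ i => ?_
  exact (Finset.single_le_sum (fun _ _ => Nat.zero_le _) (Finset.mem_univ i)).trans hγ

theorem HolderBdd.exists_holNorm_le (d : ℕ) (b : ℝ) :
    ∃ c : ℝ, 0 ≤ c ∧ ∀ (V : Type) [NormedAddCommGroup V] [NormedSpace ℝ V] (f : Euc d → V) (C : ℝ),
      HolderBdd (frc b) (ifl b) C f → holNorm b f ≤ ENNReal.ofReal (c * C) := by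
  have hfin := finite_sum_le d (ifl b)
  have hfin' : Finite {γ : Fin d → ℕ // (∑ i, γ i) = ifl b} :=
    Set.Finite.subset (s := {γ : Fin d → ℕ | (∑ i, γ i) ≤ ifl b}) hfin fun γ hγ => le_of_eq hγ
  have := Fintype.ofFinite {γ : Fin d → ℕ // (∑ i, γ i) ≤ ifl b}
  have := Fintype.ofFinite {γ : Fin d → ℕ // (∑ i, γ i) = ifl b}
  refine ⟨Fintype.card {γ : Fin d → ℕ // (∑ i, γ i) ≤ ifl b} +
    Fintype.card {γ : Fin d → ℕ // (∑ i, γ i) = ifl b}, by positivity, fun V _ _ f C hf => ?_⟩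
  have hC := hf.nonneg
  rw [add_mul, ENNReal.ofReal_add (by positivity) (by positivity),
    ENNReal.ofReal_mul (by positivity), ENNReal.ofReal_mul (by positivity),
    ENNReal.ofReal_natCast, ENNReal.ofReal_natCast, holNorm, tsum_fintype, tsum_fintype,
    ← nsmul_eq_mul, ← nsmul_eq_mul]
  refine add_le_add (Finset.sum_le_card_nsmul _ _ _ fun γ _ => ?_)
    (Finset.sum_le_card_nsmul _ _ _ fun γ _ => ?_)
  · rw [mder_eq_pderList]
    exact nrm0_le (hf.norm_pderList_le _ ((length_dirList _).trans_le γ.2))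
  · rw [mder_eq_pderList]
    refine hsemi_le hC (HolderBdd.pderList (k := 0) _ ?_).2
    rwa [zero_add, length_dirList, γ.2]

end HolderNorm

/-- A global inverse of a `C¹` map with invertible derivatives is differentiable. -/
theorem hasFDerivAt_of_inverse {E : Type*} [NormedAddCommGroup E] [NormedSpace ℝ E]
    [CompleteSpace E] {f g : E → E} (hf : ContDiff ℝ 1 f) (hgf : Function.LeftInverse g f)
    (hfg : Function.RightInverse g f) {R : E → E →L[ℝ] E} (h1 : ∀ x, fderiv ℝ f x * R x = 1)
    (h2 : ∀ x, R x * fderiv ℝ f x = 1) (y : E) : HasFDerivAt g (R (g y)) y := by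
  let e : E → E ≃L[ℝ] E := fun x => ContinuousLinearEquiv.equivOfInverse (fderiv ℝ f x) (R x)
    (fun v => congrArg (fun L : E →L[ℝ] E => L v) (h2 x))
    (fun v => congrArg (fun L : E →L[ℝ] E => L v) (h1 x))
  have hs : ∀ x, HasStrictFDerivAt f (e x : E →L[ℝ] E) x := fun x =>
    hf.contDiffAt.hasStrictFDerivAt (by norm_num)
  have hopen : IsOpenMap f := isOpenMap_of_hasStrictFDerivAt_equiv hs
  have hcont : Continuous g := by
    refine continuous_def.2 fun s hs => ?_
    rw [← Set.image_eq_preimage_of_inverse hgf hfg]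
    exact hopen s hs
  exact HasFDerivAt.of_local_left_inverse hcont.continuousAt (hs (g y)).hasFDerivAt
    (Filter.Eventually.of_forall hfg)

theorem frc_pos {b : ℝ} (hb : 0 < b) : 0 < frc b := by
  have h1 := Nat.ceil_lt_add_one hb.le
  have h2 : 1 ≤ ⌈b⌉₊ := Nat.one_le_ceil_iff.2 hb
  rw [frc, ifl, Nat.cast_sub h2]
  push_cast
  linarith

theorem frc_le_one {b : ℝ} (hb : 0 < b) : frc b ≤ 1 := by
  have h1 := Nat.le_ceil b
  have h2 : 1 ≤ ⌈b⌉₊ := Nat.one_le_ceil_iff.2 hb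
  rw [frc, ifl, Nat.cast_sub h2]
  push_cast
  linarith

/-- Hölder bound `|∇F|_{β−1} ≤ N |∇H|_{β−1}`. -/
theorem stmt_12 (d : ℕ) (hd : 1 ≤ d) (β Nκ L₃ : ℝ) (hβ : 1 < β) (hNκ : 0 < Nκ)
    (hL₃ : 0 ≤ L₃) :
    ∃ N : ℝ, 0 < N ∧
      ∀ L₀ L₁ L₂ : ℝ, 0 ≤ L₀ → 0 ≤ L₁ → 0 ≤ L₂ →
      ∀ (H Hi : Euc d → Euc d), ContDiff ℝ ((1 + ifl (β - 1) : ℕ) : ℕ) H →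
        (∀ x, ‖H x‖ ≤ L₀ + L₁ * ‖x‖) →
        (∀ x, ‖fderiv ℝ H x‖ ≤ L₂) →
        (∀ x, ∃ B : Euc d →L[ℝ] Euc d,
          (1 + fderiv ℝ H x) * B = 1 ∧ B * (1 + fderiv ℝ H x) = 1 ∧ ‖B‖ ≤ Nκ) →
        Function.LeftInverse Hi (fun x => x + H x) →
        Function.RightInverse Hi (fun x => x + H x) →
        holNorm (β - 1) (fun x => fderiv ℝ H x) ≤ ENNReal.ofReal L₃ →
        holNorm (β - 1) (fun x => fderiv ℝ (fun y => Hi y - y) x) ≤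
          ENNReal.ofReal N * holNorm (β - 1) (fun x => fderiv ℝ H x) := by
  have hb : 0 < β - 1 := by linarith
  obtain ⟨c, hc0, hc⟩ := HolderBdd.exists_inverse_sub_one (E := Euc d) (frc_pos hb)
    (frc_le_one hb) (ifl (β - 1)) hNκ.le ((d + 1) ^ ifl (β - 1) * L₃)
  obtain ⟨a, ha0, ha⟩ := HolderBdd.exists_holNorm_le d (β - 1)
  refine ⟨a * (c * (d + 1) ^ ifl (β - 1)) + 1, by positivity, ?_⟩
  intro L₀ L₁ L₂ _ _ _ H Hi hH _ _ hB hleft hright hL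
  choose R hR1 hR2 hR using hB
  have hM := ENNReal.ofReal_toReal (ne_top_of_le_ne_top ENNReal.ofReal_ne_top hL)
  set M := (holNorm (β - 1) (fun x => fderiv ℝ H x)).toReal
  have hM0 : 0 ≤ M := ENNReal.toReal_nonneg
  rw [← hM] at hL ⊢
  have hML : M ≤ L₃ := (ENNReal.ofReal_le_ofReal_iff hL₃).1 hL
  have hH1 : ContDiff ℝ 1 H := hH.of_le (by exact_mod_cast Nat.le_add_right 1 _)
  have hA := HolderBdd.of_holNorm_le hM0
    (hH.fderiv_right (m := (ifl (β - 1) : ℕ)) (by norm_cast; omega)) hM.ge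
  have hfd : ∀ x, fderiv ℝ (fun x => x + H x) x = 1 + fderiv ℝ H x := fun x =>
    ((hasFDerivAt_id x).add (hH1.differentiable (by norm_num) x).hasFDerivAt).fderiv
  have hΦ := hasFDerivAt_of_inverse (contDiff_id.add hH1) hleft hright
    (R := R) (fun x => by rw [← hR1 x, ← hfd x]; rfl) (fun x => by rw [← hR2 x, ← hfd x]; rfl)
  have hF := hc Hi _ R hR1 hR2 hR hΦ _ (by gcongr) hA
  have e : (fun x => fderiv ℝ (fun y => Hi y - y) x) = fun x => R (Hi x) - 1 :=
    funext fun x => ((hΦ x).sub (hasFDerivAt_id x)).fderiv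
  rw [e, ← ENNReal.ofReal_mul (by positivity)]
  refine (ha _ _ _ hF).trans (ENNReal.ofReal_le_ofReal ?_)
  nlinarith
end
end
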